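/- arXiv:1407.1458 — 2 statements merged into one kernel-verified Lean document; each statement's English description precedes it below -/
import Mathlib

section
/- If f is an integrable function on the circle whose Fourier coefficients vanish at all negative integers, and (k_j) is a sequence of nonnegative integers with k_{j+1} > 2 k_j for all j, then (∑_j |f̂(k_j)|²)^{1/2} ≤ 2 ‖f‖_{L¹}. -/
open MeasureTheory AddCircle

theorem fourier_natCast_eq_pow {T : ℝ} (n : ℕ) :
    (fourier (n : ℤ) : C(AddCircle T, ℂ)) = fourier 1 ^ n := by
  ext t
  simp [fourier_apply, AddCircle.toCircle_nsmul]

/-- If `fourier k * G` and `fourier 1 * a = fourier k * G ^ 2` for some `a` in the disc algebra,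
the Möbius transform `(G + c z⁻ᵏ) / (1 + conj c zᵏ G)` stays in the unit ball, and differs from
`c z⁻ᵏ + (1 - ‖c‖²) G` by an element of `z` times the disc algebra. -/
theorem exists_moebius_fourier {T : ℝ} [Fact (0 < T)] (k : ℕ) (c : ℂ) (hc : ‖c‖ < 1)
    (G : C(AddCircle T, ℂ)) (hG : ‖G‖ ≤ 1)
    (hA : fourier (k : ℤ) * G ∈ Algebra.elemental ℂ (fourier 1 : C(AddCircle T, ℂ)))
    (hsq : ∃ a ∈ Algebra.elemental ℂ (fourier 1 : C(AddCircle T, ℂ)),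
      fourier (k : ℤ) * G ^ 2 = fourier 1 * a) :
    ∃ G' : C(AddCircle T, ℂ), ‖G'‖ ≤ 1 ∧
      fourier (k : ℤ) * G' ∈ Algebra.elemental ℂ (fourier 1 : C(AddCircle T, ℂ)) ∧
      ∃ b ∈ Algebra.elemental ℂ (fourier 1 : C(AddCircle T, ℂ)),
        G' = c • fourier (-(k : ℤ)) + (1 - (‖c‖ : ℂ) ^ 2) • G + fourier 1 * b := by
  obtain ⟨a, ha, hGA⟩ := hsq
  have hzz : (fourier (k : ℤ) : C(AddCircle T, ℂ)) * fourier (-(k : ℤ)) = 1 := by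
    ext t
    rw [ContinuousMap.mul_apply, ← fourier_add, add_neg_cancel, fourier_zero,
      ContinuousMap.one_apply]
  have hcc : (starRingEnd ℂ c) * c = (‖c‖ : ℂ) ^ 2 := Complex.conj_mul' c
  let u : Algebra.elemental ℂ (fourier 1 : C(AddCircle T, ℂ)) :=
    (starRingEnd ℂ c) • ⟨_, hA⟩
  have hu : ‖-u‖ < 1 := by
    have h1 : ‖(fourier (k : ℤ) : C(AddCircle T, ℂ)) * G‖ ≤ 1 :=
      (norm_mul_le _ _).trans (by rw [fourier_norm, one_mul]; exact hG)
    have h2 : ‖u‖ = ‖c‖ * ‖(fourier (k : ℤ) : C(AddCircle T, ℂ)) * G‖ := by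
      simp only [u, norm_smul, RCLike.norm_conj]
      rfl
    rw [norm_neg, h2]
    nlinarith [norm_nonneg c]
  let w := Units.oneSub (-u) hu
  let v : C(AddCircle T, ℂ) := (↑w⁻¹ : Algebra.elemental ℂ (fourier 1 : C(AddCircle T, ℂ)))
  have hv : v ∈ Algebra.elemental ℂ (fourier 1 : C(AddCircle T, ℂ)) := Subtype.property _
  have hinv : (1 + (starRingEnd ℂ c) • (fourier (k : ℤ) * G)) * v = 1 := by
    have h := congrArg Subtype.val w.mul_inv
    simpa [w, u, v] using h
  refine ⟨(G + c • fourier (-(k : ℤ))) * v, ?_, ?_, ?_⟩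
  · rw [ContinuousMap.norm_le _ zero_le_one]
    intro t
    have h := DFunLike.congr_fun hinv t
    have hGt : ‖G t‖ ≤ 1 := (G.norm_coe_le_norm t).trans hG
    have hz := DFunLike.congr_fun hzz t
    have hzn : ‖(fourier (k : ℤ) : C(AddCircle T, ℂ)) t‖ = 1 :=
      Circle.norm_coe _
    simp only [ContinuousMap.mul_apply, ContinuousMap.add_apply, ContinuousMap.smul_apply,
      ContinuousMap.one_apply, smul_eq_mul] at h hz ⊢
    generalize (fourier (k : ℤ) : C(AddCircle T, ℂ)) t = z at *
    generalize (fourier (-(k : ℤ)) : C(AddCircle T, ℂ)) t = z' at *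
    generalize G t = g at *
    generalize v t = y at *
    have key : ‖g + c * z'‖ ≤ ‖1 + (starRingEnd ℂ c) * (z * g)‖ := by
      have h1 : ‖g + c * z'‖ = ‖z * g + c‖ := by
        rw [← one_mul ‖g + c * z'‖, ← hzn, ← norm_mul]
        congr 1
        linear_combination c * hz
      have h2 : ‖z * g‖ ≤ 1 := by rw [norm_mul, hzn, one_mul]; exact hGt
      rw [h1]
      generalize z * g = q at *
      refine le_of_sq_le_sq ?_ (norm_nonneg _)
      have h3 : ‖q‖ ^ 2 ≤ 1 := by nlinarith [norm_nonneg q]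
      have h4 : ‖c‖ ^ 2 < 1 := by nlinarith [norm_nonneg c]
      rw [Complex.sq_norm, Complex.normSq_apply] at h3 h4
      rw [Complex.sq_norm, Complex.normSq_apply, Complex.sq_norm, Complex.normSq_apply]
      simp
      nlinarith [mul_nonneg (sub_nonneg.2 h3) (sub_nonneg.2 h4.le)]
    calc ‖(g + c * z') * y‖ ≤ ‖(1 + (starRingEnd ℂ c) * (z * g)) * y‖ := by
          rw [norm_mul, norm_mul]; gcongr
      _ = 1 := by rw [h, norm_one]
  · have : fourier (k : ℤ) * ((G + c • fourier (-(k : ℤ))) * v)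
        = fourier (k : ℤ) * G * v + c • v := by
      rw [← mul_assoc, mul_add, mul_smul_comm, hzz, add_mul, smul_mul_assoc, one_mul]
    rw [this]
    exact add_mem (mul_mem hA hv) (Subalgebra.smul_mem _ hv _)
  · refine ⟨(-(1 - (‖c‖ : ℂ) ^ 2) * (starRingEnd ℂ c)) • (a * v),
      Subalgebra.smul_mem _ (mul_mem ha hv) _, ?_⟩
    ext t
    have h := DFunLike.congr_fun hinv t
    have hz := DFunLike.congr_fun hzz t
    have hga := DFunLike.congr_fun hGA t
    simp only [ContinuousMap.mul_apply, ContinuousMap.add_apply, ContinuousMap.smul_apply,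
      ContinuousMap.one_apply, ContinuousMap.pow_apply, smul_eq_mul] at h hz hga ⊢
    rw [← hcc]
    generalize (fourier (k : ℤ) : C(AddCircle T, ℂ)) t = z at *
    generalize (fourier (-(k : ℤ)) : C(AddCircle T, ℂ)) t = z' at *
    generalize (fourier 1 : C(AddCircle T, ℂ)) t = e at *
    generalize G t = g at *
    generalize v t = y at *
    generalize (starRingEnd ℂ c) = d at *
    linear_combination (c * z' + (1 - d * c) * g) * h - (1 - d * c) * d * y * hga
      - c * d * g * y * hz

/-- A continuous functional on `C(AddCircle T, ℂ)` vanishing on positive powers of `z` vanishes on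
`z` times the disc algebra. -/
theorem apply_fourier_one_mul_eq_zero {T : ℝ} [Fact (0 < T)]
    (L : C(AddCircle T, ℂ) →L[ℂ] ℂ) (hL : ∀ n : ℕ, L (fourier ((n : ℤ) + 1)) = 0)
    {a : C(AddCircle T, ℂ)} (ha : a ∈ Algebra.elemental ℂ (fourier 1 : C(AddCircle T, ℂ))) :
    L (fourier 1 * a) = 0 := by
  have hcont : Continuous fun b ↦ L (fourier 1 * b) := by fun_prop
  refine closure_minimal (t := {b | L (fourier 1 * b) = 0}) (fun b hb ↦ ?_)
    (isClosed_eq hcont continuous_const) ha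
  rw [SetLike.mem_coe, Algebra.adjoin_singleton_eq_range_aeval] at hb
  obtain ⟨p, rfl⟩ := hb
  simp only [Set.mem_ofPred_eq]
  induction p using Polynomial.induction_on' with
  | add p q hp hq =>
    rw [map_add, mul_add, map_add]
    simpa using congrArg₂ (· + ·) hp hq
  | monomial n r =>
    have : (fourier 1 : C(AddCircle T, ℂ)) * Polynomial.aeval (fourier 1) (Polynomial.monomial n r)
        = r • fourier ((n : ℤ) + 1) := by
      rw [Polynomial.aeval_monomial, ← fourier_natCast_eq_pow, ← Algebra.smul_def, mul_smul_comm]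
      congr 1
      ext t
      rw [ContinuousMap.mul_apply, ← fourier_add, add_comm]
    simpa [hL] using congrArg L this

/-- Paley's inequality for finite partial sums, for a functional on `C(AddCircle T, ℂ)`. -/
theorem sum_range_norm_sq_le_of_lacunary {T : ℝ} [Fact (0 < T)]
    (L : C(AddCircle T, ℂ) →L[ℂ] ℂ) (hL : ∀ n : ℕ, L (fourier ((n : ℤ) + 1)) = 0)
    {M : ℝ} (hM : ∀ G, ‖L G‖ ≤ M * ‖G‖)
    (k : ℕ → ℕ) (hk : ∀ j, 2 * k j < k (j + 1)) (n : ℕ) :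
    ∑ j ∈ Finset.range n, ‖L (fourier (-(k j : ℤ)))‖ ^ 2 ≤ (2 * M) ^ 2 := by
  have hx (j : ℕ) : ‖L (fourier (-(k j : ℤ)))‖ ≤ M := by
    simpa [fourier_norm] using hM (fourier (-(k j : ℤ)))
  have hM0 : 0 ≤ M := (norm_nonneg _).trans (hx 0)
  rcases hM0.eq_or_lt with rfl | hMpos
  · simp [fun j ↦ (hx j).antisymm (norm_nonneg _)]
  have hpow (m : ℕ) : (fourier (m : ℤ) : C(AddCircle T, ℂ)) ∈
      Algebra.elemental ℂ (fourier 1 : C(AddCircle T, ℂ)) := by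
    rw [fourier_natCast_eq_pow]
    exact pow_mem (Algebra.elemental.self_mem ℂ _) m
  have hre (G : C(AddCircle T, ℂ)) (hG : ‖G‖ ≤ 1) : (L G).re ≤ M :=
    (Complex.re_le_norm _).trans ((hM G).trans (mul_le_of_le_one_right hM0 hG))
  obtain ⟨G, hG, -, -, hsum⟩ : ∃ G : C(AddCircle T, ℂ), ‖G‖ ≤ 1 ∧
      fourier (k n : ℤ) * G ∈ Algebra.elemental ℂ (fourier 1 : C(AddCircle T, ℂ)) ∧
      (∃ a ∈ Algebra.elemental ℂ (fourier 1 : C(AddCircle T, ℂ)),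
        fourier (k n : ℤ) * G ^ 2 = fourier 1 * a) ∧
      ∑ j ∈ Finset.range n, ‖L (fourier (-(k j : ℤ)))‖ ^ 2 ≤ 4 * M * (L G).re := by
    induction n with
    | zero => exact ⟨0, by simp, by simp, ⟨0, zero_mem _, by simp⟩, by simp⟩
    | succ n ih =>
      obtain ⟨G, hG, hA, hsq, hsum⟩ := ih
      set x := L (fourier (-(k n : ℤ))) with hx_def
      have hxn : ‖x‖ ≤ M := hx n
      have hc : ‖(starRingEnd ℂ x) / (2 * M : ℝ)‖ = ‖x‖ / (2 * M) := by
        rw [norm_div, RCLike.norm_conj, Complex.norm_real, Real.norm_of_nonneg (by positivity)]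
      obtain ⟨G', hG', hA', b, hb, hGb⟩ := exists_moebius_fourier (k n)
        ((starRingEnd ℂ x) / (2 * M : ℝ))
        (by rw [hc, div_lt_one (by positivity)]; linarith) G hG hA hsq
      refine ⟨G', hG', ?_, ?_, ?_⟩
      · obtain ⟨d, hd⟩ := Nat.exists_eq_add_of_le (by have := hk n; omega : k n ≤ k (n + 1))
        have : (fourier (k (n + 1) : ℤ) : C(AddCircle T, ℂ)) =
            fourier (d : ℤ) * fourier (k n : ℤ) := by
          rw [hd]
          simp only [fourier_natCast_eq_pow]
          ring
        rw [this, mul_assoc]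
        exact mul_mem (hpow d) hA'
      · obtain ⟨d, hd⟩ := Nat.exists_eq_add_of_lt (hk n)
        refine ⟨fourier (d : ℤ) * (fourier (k n : ℤ) * G') ^ 2,
          mul_mem (hpow d) (pow_mem hA' 2), ?_⟩
        have : (fourier (k (n + 1) : ℤ) : C(AddCircle T, ℂ)) =
            fourier 1 * fourier (d : ℤ) * fourier (k n : ℤ) ^ 2 := by
          rw [hd]
          simp only [fourier_natCast_eq_pow]
          ring
        rw [this]
        ring
      · have hLG : (L G').re = ‖x‖ ^ 2 / (2 * M) + (1 - (‖x‖ / (2 * M)) ^ 2) * (L G).re := by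
          have h1 : (starRingEnd ℂ x) / (2 * M : ℝ) * x = ((‖x‖ ^ 2 / (2 * M) : ℝ) : ℂ) := by
            rw [div_mul_eq_mul_div, Complex.conj_mul']
            push_cast
            rfl
          have h2 : (1 - ((‖x‖ / (2 * M) : ℝ) : ℂ) ^ 2)
              = ((1 - (‖x‖ / (2 * M)) ^ 2 : ℝ) : ℂ) := by
            push_cast
            rfl
          rw [hGb, map_add, map_add, map_smul, map_smul, apply_fourier_one_mul_eq_zero L hL hb, hc,
            smul_eq_mul, smul_eq_mul, ← hx_def, h1, h2, add_zero, Complex.add_re,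
            Complex.ofReal_re, Complex.re_ofReal_mul]
        have h3 : 4 * M * (L G').re - 4 * M * (L G).re - ‖x‖ ^ 2
            = ‖x‖ ^ 2 * (M - (L G).re) / M := by
          rw [hLG]
          field_simp
          ring
        have h4 : 0 ≤ ‖x‖ ^ 2 * (M - (L G).re) / M :=
          div_nonneg (mul_nonneg (sq_nonneg _) (sub_nonneg.2 (hre G hG))) hM0
        rw [Finset.sum_range_succ]
        linarith
  nlinarith [hre G hG]

/-- **Paley's theorem** with constant 2: if `f` is integrable on the circle and its Fourier
coefficients vanish at all negative integers, and `(k j)` is a sequence of nonnegative integers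
with `k (j+1) > 2 * k j`, then `(∑ j, |f̂(k j)|²)^{1/2} ≤ 2 ‖f‖₁`. -/
theorem paley_theorem {T : ℝ} [hT : Fact (0 < T)]
    (f : AddCircle T → ℂ) (hf : Integrable f haarAddCircle)
    (hneg : ∀ n : ℤ, n < 0 → fourierCoeff f n = 0)
    (k : ℕ → ℕ) (hk : ∀ j, 2 * k j < k (j + 1)) :
    Real.sqrt (∑' j : ℕ, ‖fourierCoeff f (k j : ℤ)‖ ^ 2) ≤
      2 * ∫ t, ‖f t‖ ∂haarAddCircle := by
  have hint (G : C(AddCircle T, ℂ)) : Integrable (fun t ↦ G t * f t) haarAddCircle :=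
    hf.bdd_mul (c := ‖G‖) G.continuous.aestronglyMeasurable (.of_forall G.norm_coe_le_norm)
  have hbound (G : C(AddCircle T, ℂ)) :
      ‖∫ t, G t * f t ∂haarAddCircle‖ ≤ (∫ t, ‖f t‖ ∂haarAddCircle) * ‖G‖ := by
    rw [mul_comm, ← integral_const_mul]
    refine norm_integral_le_of_norm_le (hf.norm.const_mul _) (.of_forall fun t ↦ ?_)
    rw [norm_mul]
    gcongr
    exact G.norm_coe_le_norm t
  let L : C(AddCircle T, ℂ) →L[ℂ] ℂ := LinearMap.mkContinuous
    { toFun G := ∫ t, G t * f t ∂haarAddCircle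
      map_add' G H := by
        simp only [ContinuousMap.add_apply, add_mul]
        exact integral_add (hint G) (hint H)
      map_smul' c G := by
        simp only [ContinuousMap.smul_apply, smul_eq_mul, mul_assoc, RingHom.id_apply]
        exact integral_const_mul _ _ }
    (∫ t, ‖f t‖ ∂haarAddCircle) hbound
  have hL (n : ℤ) : L (fourier (-n)) = fourierCoeff f n := rfl
  refine Real.sqrt_le_iff.2 ⟨by positivity, ?_⟩
  refine Real.tsum_le_of_sum_range_le (fun _ ↦ by positivity) fun n ↦ ?_
  simpa only [hL] using sum_range_norm_sq_le_of_lacunary L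
    (fun m ↦ by
      rw [← neg_neg ((m : ℤ) + 1), hL]
      exact hneg _ (by omega)) hbound k hk n
end

section
/- Let (k_j)_{j=1}^J be a strictly increasing sequence of nonnegative integers with k_{j+1} > 2k_j. If f ∈ L¹(𝕋) satisfies f̂(n) = 0 for every positive integer n not in {k₁,…,k_J}, then (∑_{j=1}^J |f̂(k_j)|²)^{1/2} ≤ 2‖f‖₁. -/
open MeasureTheory AddCircle

/-- The trigonometric polynomials whose frequencies lie in `A`. -/
noncomputable def trigPolySpan (T : ℝ) (A : Set ℤ) : Submodule ℂ C(AddCircle T, ℂ) :=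
  Submodule.span ℂ (fourier '' A)

lemma fourier_mem_trigPolySpan {T : ℝ} {A : Set ℤ} {n : ℤ} (hn : n ∈ A) :
    (fourier n : C(AddCircle T, ℂ)) ∈ trigPolySpan T A :=
  Submodule.subset_span ⟨n, hn, rfl⟩

lemma trigPolySpan_mono {T : ℝ} {A B : Set ℤ} (h : A ⊆ B) :
    trigPolySpan T A ≤ trigPolySpan T B :=
  Submodule.span_mono (Set.image_mono h)

lemma fourier_mul_mem_trigPolySpan {T : ℝ} {A B : Set ℤ} {n : ℤ} (h : ∀ a ∈ A, n + a ∈ B)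
    {u : C(AddCircle T, ℂ)} (hu : u ∈ trigPolySpan T A) :
    fourier n * u ∈ trigPolySpan T B := by
  induction hu using Submodule.span_induction with
  | mem x hx =>
    obtain ⟨a, ha, rfl⟩ := hx
    have : (fourier n * fourier a : C(AddCircle T, ℂ)) = fourier (n + a) := by
      ext t; simp
    rw [this]
    exact fourier_mem_trigPolySpan (h a ha)
  | zero => simp
  | add x y _ _ hx hy => rw [mul_add]; exact add_mem hx hy
  | smul a x _ hx => rw [mul_smul_comm]; exact Submodule.smul_mem _ _ hx

lemma monotoneOn_of_two_mul_lt {n : ℕ} {k : ℕ → ℕ}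
    (hk : ∀ j, 1 ≤ j → j < n → 2 * k j < k (j + 1)) {i j : ℕ} (hi : 1 ≤ i) (hij : i ≤ j)
    (hj : j ≤ n) : k i ≤ k j := by
  induction j, hij using Nat.le_induction with
  | base => exact le_rfl
  | succ m hm ih =>
    have := hk m (by omega) (by omega)
    have := ih (by omega)
    omega

lemma norm_sq_add_norm_sq_rotation (a b c e : ℂ) (he : ‖e‖ = 1) :
    ‖a + c * (starRingEnd ℂ e * b)‖ ^ 2 + ‖b - starRingEnd ℂ c * (e * a)‖ ^ 2 =
      (‖a‖ ^ 2 + ‖b‖ ^ 2) * (1 + ‖c‖ ^ 2) := by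
  have hconj : e * starRingEnd ℂ e = 1 := by
    rw [Complex.mul_conj, Complex.normSq_eq_norm_sq, he]; simp
  apply Complex.ofReal_injective
  push_cast
  simp only [← Complex.mul_conj', map_add, map_sub, map_mul, Complex.conj_conj]
  linear_combination (c * starRingEnd ℂ c * (a * starRingEnd ℂ a + b * starRingEnd ℂ b)) * hconj

/-- Rudin–Shapiro type construction: a lacunary polynomial `∑ c j * fourier (-k j)` can be
corrected in the gaps between its frequencies to have sup norm at most `∏ (1 + |c j|²) ^ (1/2)`. -/
lemma exists_bounded_gap_correction (T : ℝ) (c : ℕ → ℂ) (k : ℕ → ℕ) (n : ℕ)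
    (hk : ∀ j, 1 ≤ j → j < n → 2 * k j < k (j + 1)) :
    ∃ g h : C(AddCircle T, ℂ),
      g ∈ trigPolySpan T {m | ∃ i, 1 ≤ i ∧ i ≤ n ∧ -(k i : ℤ) ≤ m ∧ m ≤ 0} ∧
      h - 1 ∈ trigPolySpan T {m | ∃ i, 1 ≤ i ∧ i ≤ n ∧ 0 < m ∧ m ≤ k i} ∧
      g - ∑ j ∈ Finset.Icc 1 n, c j • fourier (-(k j : ℤ)) ∈
        trigPolySpan T {m | ∃ i, 1 ≤ i ∧ i < n ∧ (k i : ℤ) < -m ∧ -m < k (i + 1)} ∧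
      ∀ t, ‖g t‖ ^ 2 + ‖h t‖ ^ 2 = ∏ j ∈ Finset.Icc 1 n, (1 + ‖c j‖ ^ 2) := by
  induction n with
  | zero => exact ⟨0, 1, by simp⟩
  | succ n ih =>
    obtain ⟨g, h, hg, hh, hgap, hnorm⟩ := ih fun j h1 h2 => hk j h1 (by omega)
    have hkn (i : ℕ) (h1 : 1 ≤ i) (h2 : i ≤ n) : 1 ≤ n ∧ k i ≤ k n ∧ 2 * k n < k (n + 1) :=
      ⟨by omega, monotoneOn_of_two_mul_lt hk h1 h2 (by omega), hk n (by omega) (by omega)⟩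
    have hdecomp : (fourier (-(k (n + 1) : ℤ)) * h : C(AddCircle T, ℂ)) =
        fourier (-(k (n + 1) : ℤ)) + fourier (-(k (n + 1) : ℤ)) * (h - 1) := by ring
    have hsmul (a : ℂ) (u v : C(AddCircle T, ℂ)) : a • (u + v) = a • u + a • v := smul_add a u v
    refine ⟨g + c (n + 1) • (fourier (-(k (n + 1) : ℤ)) * h),
      h - starRingEnd ℂ (c (n + 1)) • (fourier (k (n + 1) : ℤ) * g), ?_, ?_, ?_, fun t => ?_⟩
    · rw [hdecomp]
      refine add_mem (trigPolySpan_mono ?_ hg) (Submodule.smul_mem _ _ (add_mem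
        (fourier_mem_trigPolySpan ⟨n + 1, by omega, le_rfl, le_rfl, by omega⟩)
        (fourier_mul_mem_trigPolySpan ?_ hh)))
      · rintro m ⟨i, h1, h2, h3⟩
        exact ⟨i, h1, by omega, h3⟩
      · rintro m ⟨i, h1, h2, h3, h4⟩
        have := hkn i h1 h2
        exact ⟨n + 1, by omega, le_rfl, by omega, by omega⟩
    · rw [sub_right_comm]
      refine sub_mem (trigPolySpan_mono ?_ hh) (Submodule.smul_mem _ _
        (fourier_mul_mem_trigPolySpan ?_ hg))
      · rintro m ⟨i, h1, h2, h3⟩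
        exact ⟨i, h1, by omega, h3⟩
      · rintro m ⟨i, h1, h2, h3, h4⟩
        have := hkn i h1 h2
        exact ⟨n + 1, by omega, le_rfl, by omega, by omega⟩
    · rw [Finset.sum_Icc_succ_top (by omega), hdecomp, hsmul, add_sub_add_comm,
        add_sub_cancel_left]
      refine add_mem (trigPolySpan_mono ?_ hgap) (Submodule.smul_mem _ _
        (fourier_mul_mem_trigPolySpan ?_ hh))
      · rintro m ⟨i, h1, h2, h3⟩
        exact ⟨i, h1, by omega, h3⟩
      · rintro m ⟨i, h1, h2, h3, h4⟩
        have := hkn i h1 h2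
        exact ⟨n, by omega, by omega, by omega, by omega⟩
    · rw [Finset.prod_Icc_succ_top (by omega), ← hnorm t]
      have he : ‖(fourier (k (n + 1) : ℤ) t : ℂ)‖ = 1 := by
        rw [fourier_apply, Circle.norm_coe]
      have := norm_sq_add_norm_sq_rotation (g t) (h t) (c (n + 1)) (fourier (k (n + 1) : ℤ) t) he
      rwa [← fourier_neg] at this

section Pairing

variable {T : ℝ} [Fact (0 < T)] {f : AddCircle T → ℂ}

lemma integrable_continuousMap_mul (hf : Integrable f haarAddCircle) (u : C(AddCircle T, ℂ)) :
    Integrable (fun t => u t * f t) haarAddCircle :=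
  hf.bdd_mul u.continuous.aestronglyMeasurable (Filter.Eventually.of_forall u.norm_coe_le_norm)

/-- The linear functional on continuous functions given by integration against `f`. -/
noncomputable def integralPairing (hf : Integrable f haarAddCircle) :
    C(AddCircle T, ℂ) →ₗ[ℂ] ℂ where
  toFun u := ∫ t, u t * f t ∂haarAddCircle
  map_add' u v := by
    simp only [ContinuousMap.add_apply, add_mul]
    exact integral_add (integrable_continuousMap_mul hf u) (integrable_continuousMap_mul hf v)
  map_smul' a u := by
    simp only [ContinuousMap.smul_apply, smul_eq_mul, mul_assoc, RingHom.id_apply]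
    exact integral_const_mul a _

lemma integralPairing_fourier_neg (hf : Integrable f haarAddCircle) (n : ℤ) :
    integralPairing hf (fourier (-n)) = fourierCoeff f n := rfl

lemma integralPairing_eq_zero_of_mem (hf : Integrable f haarAddCircle) {A : Set ℤ}
    (hA : ∀ m ∈ A, fourierCoeff f (-m) = 0) {u : C(AddCircle T, ℂ)}
    (hu : u ∈ trigPolySpan T A) : integralPairing hf u = 0 := by
  have : trigPolySpan T A ≤ LinearMap.ker (integralPairing hf) := by
    refine Submodule.span_le.2 ?_
    rintro _ ⟨m, hm, rfl⟩
    have := integralPairing_fourier_neg hf (-m)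
    rw [neg_neg, hA m hm] at this
    exact this
  exact this hu

lemma norm_integralPairing_le (hf : Integrable f haarAddCircle) {u : C(AddCircle T, ℂ)} {M : ℝ}
    (hu : ∀ t, ‖u t‖ ≤ M) : ‖integralPairing hf u‖ ≤ M * ∫ t, ‖f t‖ ∂haarAddCircle := by
  rw [← integral_const_mul]
  refine norm_integral_le_of_norm_le (hf.norm.const_mul M) (Filter.Eventually.of_forall fun t => ?_)
  rw [norm_mul]
  exact mul_le_mul_of_nonneg_right (hu t) (norm_nonneg _)

end Pairing

/-- Complementary Paley-type theorem: if `(k j)_{j=1}^J` is a strictly increasing sequence of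
nonnegative integers with `k (j+1) > 2 * k j`, and `f ∈ L¹(𝕋)` has `f̂(n) = 0` for every positive
integer `n` outside `{k 1, …, k J}`, then `(∑_{j=1}^J |f̂(k j)|²)^{1/2} ≤ 2 ‖f‖₁`. -/
theorem paley_complementary {T : ℝ} [hT : Fact (0 < T)]
    (f : AddCircle T → ℂ) (hf : Integrable f haarAddCircle)
    (J : ℕ) (k : ℕ → ℕ)
    (hmono : ∀ j, 1 ≤ j → j < J → k j < k (j + 1))
    (hlac : ∀ j, 1 ≤ j → j < J → 2 * k j < k (j + 1))
    (hvanish : ∀ n : ℤ, 0 < n → (∀ j, 1 ≤ j → j ≤ J → n ≠ (k j : ℤ)) →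
      fourierCoeff f n = 0) :
    Real.sqrt (∑ j ∈ Finset.Icc 1 J, ‖fourierCoeff f (k j : ℤ)‖ ^ 2) ≤
      2 * ∫ t, ‖f t‖ ∂haarAddCircle := by
  set Q := ∑ j ∈ Finset.Icc 1 J, ‖fourierCoeff f (k j : ℤ)‖ ^ 2 with hQ
  have hQ0 : 0 ≤ Q := Finset.sum_nonneg fun _ _ => by positivity
  set S := Real.sqrt Q with hS
  have hSQ : S ^ 2 = Q := Real.sq_sqrt hQ0
  rcases (Real.sqrt_nonneg Q).eq_or_lt with h0 | hpos
  · rw [hS, ← h0]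
    exact mul_nonneg two_pos.le (integral_nonneg fun _ => norm_nonneg _)
  rw [← hS] at hpos
  let c : ℕ → ℂ := fun j => starRingEnd ℂ (fourierCoeff f (k j : ℤ)) / S
  have hc : ∑ j ∈ Finset.Icc 1 J, ‖c j‖ ^ 2 = 1 := by
    simp only [c, norm_div, RCLike.norm_conj, Complex.norm_real, Real.norm_eq_abs, div_pow,
      sq_abs, ← Finset.sum_div]
    rw [← hQ, hSQ, div_self (by rw [← hSQ]; positivity)]
  obtain ⟨g, h, -, -, hgap, hnorm⟩ := exists_bounded_gap_correction T c k J hlac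
  have hg (t) : ‖g t‖ ≤ 2 := by
    have hprod : ∏ j ∈ Finset.Icc 1 J, (1 + ‖c j‖ ^ 2) ≤ Real.exp 1 := by
      refine le_of_le_of_eq ?_ (by rw [← hc, Real.exp_sum])
      refine Finset.prod_le_prod (fun _ _ => by positivity) fun j _ => ?_
      rw [add_comm]
      exact Real.add_one_le_exp _
    have := hnorm t
    have := Real.exp_one_lt_d9
    exact abs_le_of_sq_le_sq' (by nlinarith [sq_nonneg ‖h t‖]) two_pos.le |>.2
  have hgap0 := integralPairing_eq_zero_of_mem hf (fun m hm => by
    obtain ⟨i, h1, h2, h3, h4⟩ := hm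
    refine hvanish _ (by omega) fun j hj1 hj2 hj => ?_
    rcases le_or_gt j i with hji | hji
    · have := monotoneOn_of_two_mul_lt hlac hj1 hji h2.le
      omega
    · have := monotoneOn_of_two_mul_lt hlac (by omega : 1 ≤ i + 1) hji hj2
      omega) hgap
  have hval : integralPairing hf g = S := by
    rw [map_sub, sub_eq_zero] at hgap0
    simp only [hgap0, map_sum, map_smul, integralPairing_fourier_neg, smul_eq_mul, c,
      div_mul_eq_mul_div, Complex.conj_mul', ← Finset.sum_div]
    have hS0 : (S : ℂ) ≠ 0 := by exact_mod_cast hpos.ne'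
    rw [div_eq_iff hS0, ← sq]
    exact_mod_cast hSQ.symm
  have := norm_integralPairing_le hf hg
  rwa [hval, Complex.norm_real, Real.norm_eq_abs, abs_of_pos hpos] at this
end
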